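/- arXiv:2512.13450 — 3 statements merged into one kernel-verified Lean document; each statement's English description precedes it below -/
import Mathlib

section
/- For every τ in the complex upper half-plane, G(τ) - (2τ+1)² · G(τ/(2τ+1)) = (1/32)·(2τ² + 2τ + 1). In other words, the period polynomial of the Eichler integral G for the transformation φ₂(τ) = τ/(2τ+1) is P_{φ₂}(τ) = (1/32)(2τ²+2τ+1). -/
open Real

/-- The Eichler integral `G(τ) = (1/(iπ)³) Σ_{n ≥ 1 odd} σ₋₃(n) e^{iπnτ}`, where
`σ₋₃(n) = Σ_{d ∣ n} d⁻³`. -/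
noncomputable def G (τ : ℂ) : ℂ :=
  (1 / (Complex.I * (π : ℂ)) ^ 3) *
    ∑' n : ℕ, if Odd n then
      (∑ d ∈ n.divisors, ((d : ℂ) ^ 3)⁻¹) * Complex.exp (Complex.I * π * n * τ)
    else 0

lemma tsum_odd_pnat (g : ℕ → ℂ) :
    ∑' c : ℕ+, (if Odd (c : ℕ) then g c else 0) = ∑' j : ℕ, g (2 * j + 1) := by
  have hinj : Function.Injective (fun j : ℕ => Nat.succPNat (2 * j)) := by
    intro a b h
    have := congrArg PNat.val h
    simp at this
    exact this
  rw [← Function.Injective.tsum_eq (g := fun j : ℕ => Nat.succPNat (2 * j)) (f := fun c : ℕ+ => if Odd (c : ℕ) then g c else 0) hinj]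
  · refine tsum_congr fun j => ?_
    simp
  · intro c hc
    simp only [Function.mem_support, ne_eq, ite_eq_right_iff, Classical.not_imp] at hc
    obtain ⟨⟨j, hj⟩, _⟩ := hc
    exact ⟨j, PNat.eq (by simp [hj])⟩

lemma tsum_pnat_eq_tsum_of_zero (f : ℕ → ℂ) (h0 : f 0 = 0) : ∑' n : ℕ+, f n = ∑' n, f n := by
  refine PNat.coe_injective.tsum_eq (f := f) ?_
  intro n hn
  have : n ≠ 0 := by rintro rfl; exact hn h0
  exact ⟨⟨n, Nat.pos_of_ne_zero this⟩, rfl⟩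

lemma lambert (q : ℂ) (hq : ‖q‖ < 1) :
    (∑' n : ℕ, if Odd n then (∑ d ∈ n.divisors, ((d : ℂ) ^ 3)⁻¹) * q ^ n else 0)
      = ∑' k : ℕ, (((2 * k + 1 : ℕ) : ℂ) ^ 3)⁻¹ * (q ^ (2 * k + 1) / (1 - (q ^ (2 * k + 1)) ^ 2)) := by
  obtain ⟨f, hf⟩ : ∃ f : ℕ+ × ℕ+ → ℂ, f = fun c => if Odd (c.2 : ℕ) then
    (if Odd (c.1 : ℕ) then ((c.2 : ℂ) ^ 3)⁻¹ * q ^ (c.1 * c.2 : ℕ) else 0) else 0 := ⟨_, rfl⟩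
  have hs : Summable f := by
    refine Summable.of_norm_bounded (summable_prod_mul_pow (𝕜 := ℂ) 0 hq).norm ?_
    rintro ⟨c, d⟩
    simp only [hf, pow_zero, one_mul]
    split_ifs
    · rw [norm_mul]
      refine mul_le_of_le_one_left (norm_nonneg _) ?_
      rw [norm_inv, norm_pow, Complex.norm_natCast]
      apply inv_le_one_of_one_le₀
      exact one_le_pow₀ (by exact_mod_cast d.pos)
    · simp
    · simp
  have h1 : ∑' c, f c = ∑' k : ℕ, (((2 * k + 1 : ℕ) : ℂ) ^ 3)⁻¹ * (q ^ (2 * k + 1) / (1 - (q ^ (2 * k + 1)) ^ 2)) := by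
    have hs' : Summable (fun c => f ((Equiv.prodComm ℕ+ ℕ+) c)) := (Equiv.prodComm ℕ+ ℕ+).summable_iff.mpr hs
    rw [← (Equiv.prodComm ℕ+ ℕ+).tsum_eq f, hs'.tsum_prod]
    rw [← tsum_odd_pnat (fun d => ((d : ℂ) ^ 3)⁻¹ * (q ^ d / (1 - (q ^ d) ^ 2)))]
    refine tsum_congr fun d => ?_
    simp only [hf, Equiv.prodComm_apply, Prod.swap_prod_mk]
    split_ifs with hd
    · rw [tsum_odd_pnat (fun c => ((d : ℂ) ^ 3)⁻¹ * q ^ (c * d : ℕ)), tsum_mul_left]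
      congr 1
      have h2 : ∀ j : ℕ, q ^ ((2 * j + 1) * (d : ℕ)) = q ^ (d : ℕ) * ((q ^ (d : ℕ)) ^ 2) ^ j := by
        intro j; ring
      simp_rw [h2]
      rw [tsum_mul_left, tsum_geometric_of_norm_lt_one, div_eq_mul_inv]
      rw [norm_pow, norm_pow]
      exact pow_lt_one₀ (by positivity) (pow_lt_one₀ (norm_nonneg _) hq d.ne_zero) two_ne_zero
    · simp
  have hs2 : Summable (fun c => f (sigmaAntidiagonalEquivProd c)) :=
    sigmaAntidiagonalEquivProd.summable_iff.mpr hs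
  rw [← h1, ← sigmaAntidiagonalEquivProd.tsum_eq f, hs2.tsum_sigma]
  rw [← tsum_pnat_eq_tsum_of_zero (fun n : ℕ => if Odd n then (∑ d ∈ n.divisors, ((d : ℂ) ^ 3)⁻¹) * q ^ n else 0) (by simp)]
  refine tsum_congr fun n => ?_
  have h3 : ∀ c : (n : ℕ).divisorsAntidiagonal, f (sigmaAntidiagonalEquivProd ⟨n, c⟩)
      = if Odd (n : ℕ) then (((c.1.2 : ℕ) : ℂ) ^ 3)⁻¹ * q ^ (n : ℕ) else 0 := by
    rintro ⟨⟨a, b⟩, h⟩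
    have h' := (Nat.mem_divisorsAntidiagonal.mp h).1
    have h'' : a * b = (n : ℕ) := h'
    have hv : f (sigmaAntidiagonalEquivProd ⟨n, ⟨(a, b), h⟩⟩)
      = if Odd b then (if Odd a then ((b : ℂ) ^ 3)⁻¹ * q ^ (a * b) else 0) else 0 := by
      rw [hf]; rfl
    rw [hv, h'']
    have ho : Odd (n : ℕ) ↔ Odd a ∧ Odd b := by rw [← h'', Nat.odd_mul]
    by_cases hb : Odd b <;> by_cases ha : Odd a <;> simp [ho, ha, hb]
  rw [tsum_congr h3]
  split_ifs with hn
  · rw [tsum_fintype]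
    rw [Finset.univ_eq_attach, (n : ℕ).divisorsAntidiagonal.sum_attach (fun x : ℕ × ℕ => ((x.2 : ℂ) ^ 3)⁻¹ * q ^ (n : ℕ)),
      ← Finset.sum_mul, Nat.sum_divisorsAntidiagonal' (fun _ y => ((y : ℂ) ^ 3)⁻¹)]
  · simp

lemma q_sin (w : ℂ) (h : Complex.sin w ≠ 0) :
    Complex.exp (Complex.I * w) / (1 - Complex.exp (Complex.I * w) ^ 2) = Complex.I / 2 / Complex.sin w := by
  have h1 : Complex.exp (w * Complex.I) ≠ 0 := Complex.exp_ne_zero _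
  have h2 : Complex.sin w = (1 - Complex.exp (w * Complex.I) ^ 2) / Complex.exp (w * Complex.I) * Complex.I / 2 := by
    rw [Complex.sin, neg_mul, Complex.exp_neg]; field_simp
  rw [mul_comm Complex.I w]
  have h3 : 1 - Complex.exp (w * Complex.I) ^ 2 ≠ 0 := by
    intro h0; rw [h0] at h2; simp at h2; exact h h2
  rw [h2]; field_simp

lemma sin_ne (w : ℂ) (h : 0 < w.im) : Complex.sin w ≠ 0 := by
  intro h0
  rw [Complex.sin_eq_zero_iff] at h0
  obtain ⟨k, hk⟩ := h0
  rw [hk] at h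
  simp at h

lemma im_pi_mul (k : ℕ) (τ : ℂ) (h : 0 < τ.im) : 0 < ((π : ℂ) * ((2 * k + 1 : ℕ) : ℂ) * τ).im := by
  have : ((π : ℂ) * ((2 * k + 1 : ℕ) : ℂ) * τ).im = π * ((2 * k + 1 : ℕ) : ℝ) * τ.im := by
    rw [← Complex.ofReal_natCast, ← Complex.ofReal_mul, Complex.im_ofReal_mul]
  rw [this]
  positivity

lemma G_eq (τ : ℂ) (h : 0 < τ.im) :
    -(2 * (π : ℂ) ^ 3) * G τ = ∑' k : ℕ, (((2 * k + 1 : ℕ) : ℂ) ^ 3)⁻¹ * (Complex.sin (π * ((2 * k + 1 : ℕ) : ℂ) * τ))⁻¹ := by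
  have hq : ‖Complex.exp (Complex.I * π * τ)‖ < 1 := by
    rw [Complex.norm_exp, Real.exp_lt_one_iff]
    simp
    positivity
  have h1 : ∀ n : ℕ, Complex.exp (Complex.I * π * n * τ) = Complex.exp (Complex.I * π * τ) ^ n := by
    intro n; rw [← Complex.exp_nat_mul]; congr 1; ring
  unfold G
  simp_rw [h1]
  rw [lambert _ hq]
  have h2 : ∀ k : ℕ, (((2 * k + 1 : ℕ) : ℂ) ^ 3)⁻¹ * (Complex.exp (Complex.I * π * τ) ^ (2 * k + 1) / (1 - (Complex.exp (Complex.I * π * τ) ^ (2 * k + 1)) ^ 2))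
     = (Complex.I / 2) * ((((2 * k + 1 : ℕ) : ℂ) ^ 3)⁻¹ * (Complex.sin (π * ((2 * k + 1 : ℕ) : ℂ) * τ))⁻¹) := by
    intro k
    have := q_sin _ (sin_ne _ (im_pi_mul k τ h))
    rw [← h1, show Complex.I * π * ((2 * k + 1 : ℕ) : ℂ) * τ = Complex.I * (π * ((2 * k + 1 : ℕ) : ℂ) * τ) by ring, this]
    ring
  simp_rw [h2]
  rw [tsum_mul_left]
  have hp : (π : ℂ) ≠ 0 := by exact_mod_cast Real.pi_ne_zero
  rw [mul_pow, Complex.I_pow_three]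
  generalize (∑' k : ℕ, (((2 * k + 1 : ℕ) : ℂ) ^ 3)⁻¹ * (Complex.sin (π * ((2 * k + 1 : ℕ) : ℂ) * τ))⁻¹) = S
  field_simp

open Complex in
lemma cot_hasSum (x : ℂ) (hx : x ∈ Complex.integerComplement) :
    HasSum (fun n : ℕ => 1 / (x - (n + 1)) + 1 / (x + (n + 1))) (π * Complex.cot (π * x) - 1 / x) := by
  rw [cot_series_rep' hx]
  exact (summable_cotTerm hx).hasSum

/-- the term -/
noncomputable def gt (z : ℂ) (k : ℕ) : ℂ :=
  (-1) ^ k * (2 * (2 * k + 1 : ℂ) / (z ^ 2 - (2 * k + 1) ^ 2))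

lemma cot_sub (u : ℂ) (h1 : Complex.sin u ≠ 0) (h2 : Complex.sin (u + π / 2) ≠ 0) :
    Complex.cot u - Complex.cot (u + π / 2) = 2 / Complex.sin (2 * u) := by
  have e1 : Complex.sin (u + π / 2) = Complex.cos u := Complex.sin_add_pi_div_two u
  have e2 : Complex.cos (u + π / 2) = - Complex.sin u := Complex.cos_add_pi_div_two u
  rw [e1] at h2
  rw [Complex.cot, Complex.cot, e1, e2, Complex.sin_two_mul]
  field_simp
  linear_combination Complex.sin_sq_add_cos_sq u

lemma ne_of_notOdd (z : ℂ) (hz : ∀ m : ℤ, z ≠ 2 * m + 1) :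
    (z - 1) / 4 ∈ Complex.integerComplement ∧ (z + 1) / 4 ∈ Complex.integerComplement := by
  constructor
  · rintro ⟨m, hm⟩
    apply hz (2 * m); push_cast; rw [hm]; ring
  · rintro ⟨m, hm⟩
    apply hz (2 * m - 1); push_cast; rw [hm]; ring

lemma paired (z : ℂ) (hz : ∀ m : ℤ, z ≠ 2 * m + 1) :
    HasSum (fun n : ℕ => gt z (2 * n + 1) + gt z (2 * n + 2))
      (-(π / 2) / Complex.cos (π * z / 2) - gt z 0) := by
  obtain ⟨hx, hy⟩ := ne_of_notOdd z hz
  have H := ((cot_hasSum _ hx).sub (cot_hasSum _ hy)).mul_left (1 / 4)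
  have hne : ∀ m : ℤ, z - (2 * m + 1) ≠ 0 := fun m => sub_ne_zero.mpr (hz m)
  have hz1 : z - 1 ≠ 0 := by simpa using hne 0
  have hz2 : z + 1 ≠ 0 := by have := hne (-1); push_cast at this; convert this using 1; ring
  convert! H using 1
  · funext n
    have a1 := hne (2 * n + 2)
    have a2 := hne (-(2 * n + 2))
    have a3 := hne (2 * n + 1)
    have a4 := hne (-(2 * n + 1) - 2)
    push_cast at a1 a2 a3 a4
    have b1 : z - (4 * n + 5) ≠ 0 := by convert a1 using 1; ring
    have b2 : z + (4 * n + 3) ≠ 0 := by convert a2 using 1; ring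
    have b3 : z - (4 * n + 3) ≠ 0 := by convert a3 using 1; ring
    have b4 : z + (4 * n + 5) ≠ 0 := by convert a4 using 1; ring
    have c1 : z ^ 2 - (4 * n + 5) ^ 2 = (z - (4 * n + 5)) * (z + (4 * n + 5)) := by ring
    have c2 : z ^ 2 - (4 * n + 3) ^ 2 = (z - (4 * n + 3)) * (z + (4 * n + 3)) := by ring
    have e1 : gt z (2 * n + 1) = - (1 / (z - (4 * n + 3)) - 1 / (z + (4 * n + 3))) := by
      have : gt z (2 * n + 1) = -(2 * (4 * n + 3) / (z ^ 2 - (4 * n + 3) ^ 2)) := by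
        unfold gt; rw [pow_succ, pow_mul]; push_cast; norm_num; ring
      rw [this, c2]; field_simp; ring
    have e2 : gt z (2 * n + 2) = (1 / (z - (4 * n + 5)) - 1 / (z + (4 * n + 5))) := by
      have : gt z (2 * n + 2) = (2 * (4 * n + 5) / (z ^ 2 - (4 * n + 5) ^ 2)) := by
        unfold gt; rw [pow_add, pow_mul]; push_cast; norm_num; ring
      rw [this, c1]; field_simp; ring
    rw [e1, e2]
    rw [show (z - 1) / 4 - (n + 1) = (z - (4 * n + 5)) / 4 by ring,
      show (z - 1) / 4 + (n + 1) = (z + (4 * n + 3)) / 4 by ring,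
      show (z + 1) / 4 - (n + 1) = (z - (4 * n + 3)) / 4 by ring,
      show (z + 1) / 4 + (n + 1) = (z + (4 * n + 5)) / 4 by ring]
    field_simp; ring
  · have s1 := sin_pi_mul_ne_zero hx
    have s2 := sin_pi_mul_ne_zero hy
    have e : (π : ℂ) * ((z + 1) / 4) = π * ((z - 1) / 4) + π / 2 := by ring
    rw [e] at s2
    have := cot_sub _ s1 s2
    rw [← e] at this
    have e3 : Complex.sin (2 * (π * ((z - 1) / 4))) = - Complex.cos (π * z / 2) := by
      rw [← Complex.sin_sub_pi_div_two]; congr 1; ring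
    rw [e3] at this
    have e4 : gt z 0 = 1 / (z - 1) - 1 / (z + 1) := by
      unfold gt
      have : z ^ 2 - (2 * ((0 : ℕ) : ℂ) + 1) ^ 2 = (z - 1) * (z + 1) := by push_cast; ring
      rw [this]; field_simp; push_cast; ring
    rw [e4]
    have e5 : (1 : ℂ) / ((z - 1) / 4) = 4 * (1 / (z - 1)) := by field_simp
    have e6 : (1 : ℂ) / ((z + 1) / 4) = 4 * (1 / (z + 1)) := by field_simp
    rw [e5, e6]
    linear_combination (-(π : ℂ) / 4) * this

/-- combined term -/
noncomputable def ft (z : ℂ) (k : ℕ) : ℂ :=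
  (-1) ^ k * (2 * z ^ 2 / ((2 * k + 1 : ℂ) * (z ^ 2 - (2 * k + 1) ^ 2)))

lemma odd_ne (k : ℕ) : (2 * k + 1 : ℂ) ≠ 0 := by exact_mod_cast (by omega : 2 * k + 1 ≠ 0)

lemma ft_eq (z : ℂ) (hz : ∀ m : ℤ, z ≠ 2 * m + 1) (k : ℕ) : ft z k = gt z k - gt 0 k := by
  have h0 := odd_ne k
  have h1 : z ^ 2 - (2 * k + 1 : ℂ) ^ 2 ≠ 0 := by
    have : z ^ 2 - (2 * k + 1 : ℂ) ^ 2 = (z - (2 * k + 1)) * (z + (2 * k + 1)) := by ring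
    rw [this]
    refine mul_ne_zero (sub_ne_zero.mpr (by simpa using hz k)) ?_
    have := sub_ne_zero.mpr (hz (-k - 1))
    push_cast at this
    convert this using 1; ring
  unfold ft gt
  rw [← mul_sub]
  congr 1
  rw [zero_pow two_ne_zero, zero_sub]
  field_simp
  ring

lemma ft_tsum (z : ℂ) (hz : ∀ m : ℤ, z ≠ 2 * m + 1) (hs : Summable (ft z)) :
    ∑' k, ft z k = π / 2 * (1 - 1 / Complex.cos (π * z / 2)) := by
  have h0 : ∀ m : ℤ, (0 : ℂ) ≠ 2 * m + 1 := by
    intro m h; have : (0 : ℤ) = 2 * m + 1 := by exact_mod_cast h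
    omega
  have H := (paired z hz).sub (paired 0 h0)
  have hs' : Summable (fun n => ft z (n + 1)) := (summable_nat_add_iff 1).mpr hs
  have H2 : ∑' n, ft z (n + 1) = ∑' n, (gt z (2 * n + 1) + gt z (2 * n + 2) - (gt 0 (2 * n + 1) + gt 0 (2 * n + 2))) := by
    have se : Summable (fun n => ft z (2 * n + 1)) := hs.comp_injective (i := fun n => 2 * n + 1) (fun a b h => by simpa using h)
    have so : Summable (fun n => ft z (2 * n + 2)) := hs.comp_injective (i := fun n => 2 * n + 2) (fun a b h => by simpa using h)
    rw [← tsum_even_add_odd (f := fun n => ft z (n + 1)) se so, ← se.tsum_add so]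
    refine tsum_congr fun n => ?_
    simp only [ft_eq z hz]; ring
  rw [hs.tsum_eq_zero_add, H2, H.tsum_eq, ft_eq z hz]
  simp
  ring

lemma beta3 : ∑' k : ℕ, (-1 : ℂ) ^ k * (((2 * k + 1 : ℕ) : ℂ) ^ 3)⁻¹ = π ^ 3 / 32 := by
  have h := hasSum_L_function_mod_four_eval_three
  have hinj : Function.Injective (fun k : ℕ => 2 * k + 1) := fun a b h => by simpa using h
  rw [← hinj.hasSum_iff] at h
  · have h2 := (Complex.hasSum_ofReal.mpr h).tsum_eq
    push_cast at h2
    rw [← h2]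
    refine tsum_congr fun k => ?_
    simp only [Function.comp]
    have : Real.sin (π * ((2 * k + 1 : ℕ) : ℝ) / 2) = (-1) ^ k := by
      rw [show π * ((2 * k + 1 : ℕ) : ℝ) / 2 = π / 2 + k * π by push_cast; ring, Real.sin_add_nat_mul_pi]
      simp
    rw [this]; push_cast; ring
  · intro n hn
    have he : Even n := by
      by_contra hc
      rw [Nat.not_even_iff_odd] at hc
      obtain ⟨k, hk⟩ := hc
      exact hn ⟨k, hk.symm⟩
    obtain ⟨k, rfl⟩ := he
    have : Real.sin (π * ((k + k : ℕ) : ℝ) / 2) = 0 := by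
      rw [show π * ((k + k : ℕ) : ℝ) / 2 = k * π by push_cast; ring, Real.sin_nat_mul_pi]
    rw [this, mul_zero]

/-- double series term -/
noncomputable def Kt (s : ℂ) (p : ℕ × ℕ) : ℂ :=
  (-1) ^ p.1 * (-1) ^ p.2 * (2 * s ^ 2 / ((2 * p.1 + 1 : ℂ) * (2 * p.2 + 1) * ((2 * p.1 + 1 : ℂ) ^ 2 * s ^ 2 - (2 * p.2 + 1) ^ 2)))

lemma Kt_den (s : ℂ) (hs : 0 < s.im) (a b : ℝ) (ha : 0 < a) (hb : 0 < b) :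
    a * b * (s.im ^ 2 / ‖s‖) ≤ ‖(a : ℂ) ^ 2 * s ^ 2 - (b : ℂ) ^ 2‖ := by
  have hn : 0 < ‖s‖ := norm_pos_iff.mpr (by rintro rfl; simp at hs)
  have h1 : a * s.im ≤ ‖(a : ℂ) * s - b‖ := by
    have := Complex.abs_im_le_norm ((a : ℂ) * s - b)
    have e : ((a : ℂ) * s - b).im = a * s.im := by simp
    rw [e] at this
    exact (le_abs_self _).trans this
  have h2 : b * s.im / ‖s‖ ≤ ‖(a : ℂ) * s + b‖ := by
    rw [div_le_iff₀ hn]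
    have := Complex.abs_im_le_norm (((a : ℂ) * s + b) * (starRingEnd ℂ) s)
    have e : (((a : ℂ) * s + b) * (starRingEnd ℂ) s).im = - (b * s.im) := by
      simp; ring
    rw [e, norm_mul, Complex.norm_conj, abs_neg] at this
    exact (le_abs_self _).trans this
  have h3 : (a : ℂ) ^ 2 * s ^ 2 - (b : ℂ) ^ 2 = ((a : ℂ) * s - b) * ((a : ℂ) * s + b) := by ring
  rw [h3, norm_mul]
  calc _ = (a * s.im) * (b * s.im / ‖s‖) := by ring
    _ ≤ _ := by gcongr

lemma Kt_summable (s : ℂ) (hs : 0 < s.im) : Summable (Kt s) := by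
  have hn : 0 < ‖s‖ := norm_pos_iff.mpr (by rintro rfl; simp at hs)
  have h0 : Summable (fun k : ℕ => 1 / (2 * k + 1 : ℝ) ^ 2) := by
    have := (Real.summable_one_div_nat_pow (p := 2)).mpr (by norm_num)
    have := this.comp_injective (i := fun k => 2 * k + 1) (fun a b h => by simpa using h)
    refine this.congr fun k => ?_
    simp
  have h1 := ((h0.mul_of_nonneg h0 (fun k => by positivity) (fun k => by positivity))).mul_left (2 * ‖s‖ ^ 2 * (‖s‖ / s.im ^ 2))
  refine Summable.of_norm_bounded h1 ?_
  rintro ⟨k, j⟩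
  have h := Kt_den s hs (2 * k + 1) (2 * j + 1) (by positivity) (by positivity)
  have ek : ‖(2 * k + 1 : ℂ)‖ = 2 * k + 1 := by
    rw [show (2 * k + 1 : ℂ) = ((2 * k + 1 : ℕ) : ℂ) by push_cast; ring, Complex.norm_natCast]; push_cast; ring
  have ej : ‖(2 * j + 1 : ℂ)‖ = 2 * j + 1 := by
    rw [show (2 * j + 1 : ℂ) = ((2 * j + 1 : ℕ) : ℂ) by push_cast; ring, Complex.norm_natCast]; push_cast; ring
  push_cast at h
  simp only [Kt, norm_mul, norm_pow, norm_neg, norm_one, one_pow, one_mul, norm_div, ek, ej]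
  rw [Complex.norm_ofNat]
  have hp : 0 < (2 * k + 1 : ℝ) * (2 * j + 1) * (s.im ^ 2 / ‖s‖) := by positivity
  calc _ ≤ 2 * ‖s‖ ^ 2 / ((2 * k + 1) * (2 * j + 1) * ((2 * k + 1 : ℝ) * (2 * j + 1) * (s.im ^ 2 / ‖s‖))) := by
        gcongr
    _ = _ := by field_simp

lemma ne_odd_of_im (z : ℂ) (h : z.im ≠ 0) (m : ℤ) : z ≠ 2 * m + 1 := by
  rintro rfl; simp at h

lemma rowA (s : ℂ) (hs : 0 < s.im) (k : ℕ) :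
    ∑' j, Kt s (k, j) = (-1) ^ k * (((2 * k + 1 : ℕ) : ℂ) ^ 3)⁻¹ * (π / 2 * (1 - 1 / Complex.cos (π * ((2 * k + 1 : ℕ) * s) / 2))) := by
  have ha : ((2 * k + 1 : ℕ) : ℂ) ≠ 0 := by exact_mod_cast (by omega : 2 * k + 1 ≠ 0)
  have e : ∀ j, ft ((2 * k + 1 : ℕ) * s) j = (-1) ^ k * ((2 * k + 1 : ℕ) : ℂ) ^ 3 * Kt s (k, j) := by
    intro j
    have hsq : ((-1 : ℂ) ^ k) * (-1) ^ k = 1 := by rw [← mul_pow]; simp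
    have hb := odd_ne j
    have hd : (((2 * k + 1 : ℕ) : ℂ)) ^ 2 * s ^ 2 - (2 * j + 1) ^ 2 ≠ 0 := by
      have h := Kt_den s hs (2 * k + 1) (2 * j + 1) (by positivity) (by positivity)
      push_cast at h ⊢
      have hn : 0 < ‖s‖ := norm_pos_iff.mpr (by rintro rfl; simp at hs)
      refine norm_pos_iff.mp (lt_of_lt_of_le (by positivity) h)
    unfold ft Kt
    rw [mul_pow, show (2 * (k : ℂ) + 1) = ((2 * k + 1 : ℕ) : ℂ) by push_cast; ring]
    simp only
    generalize ((2 * k + 1 : ℕ) : ℂ) = a at *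
    calc _ = ((-1 : ℂ) ^ k * (-1) ^ k) * (-1) ^ j * (2 * (a ^ 2 * s ^ 2) / ((2 * j + 1) * (a ^ 2 * s ^ 2 - (2 * j + 1) ^ 2))) := by rw [hsq, one_mul]
      _ = _ := by field_simp
  have hrow := (Kt_summable s hs).prod_factor k
  have hft : Summable (ft ((2 * k + 1 : ℕ) * s)) := by
    refine (hrow.mul_left ((-1) ^ k * ((2 * k + 1 : ℕ) : ℂ) ^ 3)).congr fun j => ?_
    rw [e]
  have him : (((2 * k + 1 : ℕ) : ℂ) * s).im ≠ 0 := by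
    have : (((2 * k + 1 : ℕ) : ℂ) * s).im = ((2 * k + 1 : ℕ) : ℝ) * s.im := by
      rw [← Complex.ofReal_natCast, Complex.im_ofReal_mul]
    rw [this]; positivity
  have h1 := ft_tsum _ (ne_odd_of_im _ him) hft
  rw [tsum_congr e, tsum_mul_left] at h1
  rw [← h1]
  have hsq : ((-1 : ℂ) ^ k) * (-1) ^ k = 1 := by rw [← mul_pow]; simp
  field_simp
  rw [sq, hsq, mul_one]

lemma Kt_swap (s : ℂ) (hs : 0 < s.im) (j k : ℕ) : s ^ 2 * Kt (-1 / s) (j, k) = - Kt s (k, j) := by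
  have h0 : s ≠ 0 := by rintro rfl; simp at hs
  have hd : (2 * k + 1 : ℂ) ^ 2 * s ^ 2 - (2 * j + 1) ^ 2 ≠ 0 := by
    have h := Kt_den s hs (2 * k + 1) (2 * j + 1) (by positivity) (by positivity)
    push_cast at h ⊢
    have hn : 0 < ‖s‖ := norm_pos_iff.mpr h0
    refine norm_pos_iff.mp (lt_of_lt_of_le (by positivity) h)
  have hd' : (2 * j + 1 : ℂ) ^ 2 - (2 * k + 1) ^ 2 * s ^ 2 ≠ 0 := by
    rw [← neg_ne_zero]; convert hd using 1; ring
  have ha := odd_ne k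
  have hb := odd_ne j
  have e : (2 * j + 1 : ℂ) ^ 2 * (-1 / s) ^ 2 - (2 * k + 1) ^ 2 = ((2 * j + 1 : ℂ) ^ 2 - (2 * k + 1) ^ 2 * s ^ 2) / s ^ 2 := by
    field_simp
  unfold Kt
  simp only
  rw [e]
  generalize (2 * j + 1 : ℂ) = b at *
  generalize (2 * k + 1 : ℂ) = a at *
  have e2 : a ^ 2 * s ^ 2 - b ^ 2 = - (b ^ 2 - a ^ 2 * s ^ 2) := by ring
  rw [e2]
  field_simp


lemma cosA (τ : ℂ) (k : ℕ) :
    Complex.cos (π * ((2 * k + 1 : ℕ) * (2 * τ + 1)) / 2) = (-1) * (-1) ^ k * Complex.sin (π * ((2 * k + 1 : ℕ) : ℂ) * τ) := by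
  have e : (π : ℂ) * ((2 * k + 1 : ℕ) * (2 * τ + 1)) / 2 = π * ((2 * k + 1 : ℕ) : ℂ) * τ + π / 2 + k * π := by
    push_cast; ring
  rw [e, Complex.cos_antiperiodic.add_nat_mul_eq, Complex.cos_add_pi_div_two]
  push_cast; ring

lemma cosB (τ : ℂ) (k : ℕ) :
    Complex.cos (π * ((2 * k + 1 : ℕ) * (2 * τ - 1)) / 2) = 1 * (-1) ^ k * Complex.sin (π * ((2 * k + 1 : ℕ) : ℂ) * τ) := by
  have e : (π : ℂ) * ((2 * k + 1 : ℕ) * (2 * τ - 1)) / 2 = π * ((2 * k + 1 : ℕ) : ℂ) * τ - π / 2 - k * π := by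
    push_cast; ring
  rw [e, Complex.cos_antiperiodic.sub_nat_mul_eq, Complex.cos_sub_pi_div_two]
  push_cast; ring

lemma total (s τ ε : ℂ) (hs : 0 < s.im) (hτ : 0 < τ.im) (hε : ε ^ 2 = 1)
    (h : ∀ k : ℕ, Complex.cos (π * ((2 * k + 1 : ℕ) * s) / 2) = ε * (-1) ^ k * Complex.sin (π * ((2 * k + 1 : ℕ) : ℂ) * τ)) :
    ∑' p, Kt s p = π / 2 * (π ^ 3 / 32 + 2 * ε * π ^ 3 * G τ) := by
  have hp : (π : ℂ) ≠ 0 := by exact_mod_cast Real.pi_ne_zero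
  have hK := Kt_summable s hs
  have hrow := hK.prod
  have hb : Summable (fun k : ℕ => (-1 : ℂ) ^ k * (((2 * k + 1 : ℕ) : ℂ) ^ 3)⁻¹) := by
    have := (Real.summable_one_div_nat_pow (p := 3)).mpr (by norm_num)
    have := this.comp_injective (i := fun k => 2 * k + 1) (fun a b h => by simpa using h)
    refine Summable.of_norm_bounded this fun k => ?_
    simp only [norm_mul, norm_pow, norm_neg, norm_one, one_pow, one_mul, norm_inv, Complex.norm_natCast,
      Function.comp, one_div]
    exact le_rfl
  have e : ∀ k : ℕ, (((2 * k + 1 : ℕ) : ℂ) ^ 3)⁻¹ * (Complex.sin (π * ((2 * k + 1 : ℕ) : ℂ) * τ))⁻¹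
      = ε * ((-1 : ℂ) ^ k * (((2 * k + 1 : ℕ) : ℂ) ^ 3)⁻¹ - 2 / π * ∑' j, Kt s (k, j)) := by
    intro k
    have hsn := sin_ne _ (im_pi_mul k τ hτ)
    have hε0 : ε ≠ 0 := by rintro rfl; simp at hε
    have hsq : ((-1 : ℂ) ^ k) ^ 2 = 1 := by rw [← pow_mul, mul_comm, pow_mul]; simp
    have hk0 : ((-1 : ℂ) ^ k) ≠ 0 := by intro h0; rw [h0] at hsq; simp at hsq
    have ha : ((2 * k + 1 : ℕ) : ℂ) ≠ 0 := by exact_mod_cast (by omega : 2 * k + 1 ≠ 0)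
    rw [rowA s hs k, h k]
    generalize Complex.sin (π * ((2 * k + 1 : ℕ) : ℂ) * τ) = S at *
    generalize ((2 * k + 1 : ℕ) : ℂ) = a at *
    generalize (-1 : ℂ) ^ k = x at *
    field_simp
    ring
  have hG := G_eq τ hτ
  rw [tsum_congr e, tsum_mul_left, (hb.tsum_sub (hrow.mul_left _)), beta3, tsum_mul_left, ← hK.tsum_prod] at hG
  generalize ∑' p, Kt s p = T at *
  have h2 : ε * (-(2 * π ^ 3) * G τ) = ε ^ 2 * (π ^ 3 / 32 - 2 / π * T) := by rw [hG]; ring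
  rw [hε] at h2
  have h3 : T = π / 2 * (2 / π * T) := by field_simp
  rw [h3]
  linear_combination ((π : ℂ) / 2) * h2

/-- Proposition 6.6. For `τ` in the upper half-plane,
`G(τ) - (2τ+1)² G(τ/(2τ+1)) = (1/32)(2τ² + 2τ + 1)`; i.e. the period polynomial of `G`
for `φ₂(τ) = τ/(2τ+1)` is `P_{φ₂}(τ) = (1/32)(2τ²+2τ+1)`. -/
theorem stmt_17 (τ : ℂ) (hτ : 0 < τ.im) :
    G τ - (2 * τ + 1) ^ 2 * G (τ / (2 * τ + 1)) = (1 / 32) * (2 * τ ^ 2 + 2 * τ + 1) := by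
  have hs : 0 < (2 * τ + 1).im := by simp [hτ]
  have hs0 : (2 * τ + 1) ≠ 0 := by intro h; rw [h] at hs; simp at hs
  have inv_im : ∀ w : ℂ, 0 < w.im → 0 < (-1 / w).im := by
    intro w hw
    have hw0 : w ≠ 0 := by rintro rfl; simp at hw
    rw [neg_div, one_div, Complex.neg_im, Complex.inv_im]
    have : 0 < Complex.normSq w := Complex.normSq_pos.mpr hw0
    rw [neg_div, neg_neg]
    positivity
  have hs' := inv_im _ hs
  have e' : 2 * (τ / (2 * τ + 1)) - 1 = -1 / (2 * τ + 1) := by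
    field_simp; ring
  have hτ' : 0 < (τ / (2 * τ + 1)).im := by
    have h1 : (2 * (τ / (2 * τ + 1)) - 1).im = 2 * (τ / (2 * τ + 1)).im := by
      rw [Complex.sub_im, Complex.mul_im]; simp
    rw [← e', h1] at hs'
    linarith
  have A := total (2 * τ + 1) τ (-1) hs hτ (by norm_num) (cosA τ)
  have B := total (-1 / (2 * τ + 1)) (τ / (2 * τ + 1)) 1 hs' hτ' (by norm_num) (by
    intro k; rw [← e']; exact cosB _ k)
  have C : (2 * τ + 1) ^ 2 * ∑' p, Kt (-1 / (2 * τ + 1)) p = - ∑' p, Kt (2 * τ + 1) p := by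
    rw [← tsum_mul_left, ← (Equiv.prodComm ℕ ℕ).tsum_eq (Kt (2 * τ + 1)), ← tsum_neg]
    refine tsum_congr fun p => ?_
    exact Kt_swap _ hs p.1 p.2
  rw [A, B] at C
  have hp : (π : ℂ) ≠ 0 := by exact_mod_cast Real.pi_ne_zero
  have hp4 : (π : ℂ) ^ 4 ≠ 0 := pow_ne_zero _ hp
  apply mul_left_cancel₀ hp4
  linear_combination -C
end

section
/- Let θ be a diophantine irrational real number. Then lim_{t → 0⁺} G(θ + it) = -(1/32)·Λ(θ), i.e., the boundary value of the Eichler integral G at θ along the vertical line is -Λ(θ)/32. -/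
open Real Filter

/-- A real number `θ` is diophantine if for every `ε > 0` there is `C > 0` with
`|nθ - ℓ| ≥ C·n^{-1-ε}` for all integers `n ≥ 1` and all `ℓ ∈ ℤ`. -/
def Diophantine (θ : ℝ) : Prop :=
  ∀ ε : ℝ, 0 < ε → ∃ C : ℝ, 0 < C ∧ ∀ n : ℕ, 1 ≤ n → ∀ ℓ : ℤ,
    C * (n : ℝ) ^ (-1 - ε) ≤ |(n : ℝ) * θ - (ℓ : ℝ)|

/-- `Λ(θ) = (16/π³) Σ_{n ≥ 1 odd} 1/(n³ sin(nπθ))`. -/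
noncomputable def Lam (θ : ℝ) : ℝ :=
  (16 / π ^ 3) * ∑' n : ℕ, if Odd n then 1 / ((n : ℝ) ^ 3 * Real.sin (n * π * θ)) else 0

lemma sin_lower (θ : ℝ) (C e : ℝ) (h : ∀ n : ℕ, 1 ≤ n → ∀ ℓ : ℤ,
    C * (n : ℝ) ^ e ≤ |(n : ℝ) * θ - (ℓ : ℝ)|) (n : ℕ) (hn : 1 ≤ n) :
    2 * (C * (n : ℝ) ^ e) ≤ |Real.sin (n * π * θ)| := by
  have h1 := h n hn (round ((n : ℝ) * θ))
  have h2 := abs_sub_round ((n : ℝ) * θ)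
  set ℓ := round ((n : ℝ) * θ) with hℓ
  have hpi := Real.pi_pos
  have h3 : |Real.sin (n * π * θ)| = |Real.sin (π * (n * θ - ℓ))| := by
    have : π * (n * θ - ℓ) = n * π * θ - ℓ * π := by ring
    rw [this, Real.sin_sub_int_mul_pi, abs_mul]
    simp [abs_zpow]
  have h4 : |π * (n * θ - ℓ)| = π * |n * θ - ℓ| := by
    rw [abs_mul, abs_of_pos hpi]
  have h5 := Real.mul_abs_le_abs_sin (x := π * (n * θ - ℓ)) (by rw [h4]; nlinarith)
  rw [h3]
  refine le_trans ?_ h5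
  have h6 : 2 / π * (π * |n * θ - ℓ|) = 2 * |n * θ - ℓ| := by field_simp
  rw [h4, h6]
  linarith

lemma norm_sin_ge (x y : ℝ) : |Real.sin x| ≤ ‖Complex.sin ((x : ℂ) + y * Complex.I)‖ := by
  have h : Complex.sin ((x : ℂ) + y * Complex.I) =
      ((Real.sin x * Real.cosh y : ℝ) : ℂ) + ((Real.cos x * Real.sinh y : ℝ) : ℂ) * Complex.I := by
    rw [Complex.sin_add_mul_I]; push_cast; ring
  have hre : (Complex.sin ((x : ℂ) + y * Complex.I)).re = Real.sin x * Real.cosh y := by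
    rw [h]; simp only [Complex.add_re, Complex.re_ofReal_mul, Complex.ofReal_re, Complex.I_re]; ring
  refine le_trans ?_ (Complex.abs_re_le_norm _)
  rw [hre, abs_mul, abs_of_pos (Real.cosh_pos y)]
  nlinarith [Real.one_le_cosh y, abs_nonneg (Real.sin x)]

lemma hasSum_odd_geom (x : ℂ) (hx : ‖x‖ < 1) :
    HasSum (fun m : ℕ => if Odd m then x ^ m else 0) (x * (1 - x ^ 2)⁻¹) := by
  have hx2 : ‖x ^ 2‖ < 1 := by
    rw [norm_pow]; exact pow_lt_one₀ (norm_nonneg _) hx two_ne_zero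
  have h := (hasSum_geometric_of_norm_lt_one hx2).mul_left x
  have hinj : Function.Injective (fun k : ℕ => 2 * k + 1) := fun a b h => by
    simp only at h; omega
  rw [← hinj.hasSum_iff]
  · have hE : ((fun m : ℕ => if Odd m then x ^ m else 0) ∘ fun k : ℕ => 2 * k + 1) =
        fun i : ℕ => x * (x ^ 2) ^ i := by
      funext k
      have hk : Odd (2 * k + 1) := ⟨k, rfl⟩
      simp only [Function.comp, if_pos hk]; ring
    rw [hE]
    exact h
  · intro m hm
    rw [if_neg]
    rintro ⟨k, hk⟩
    exact hm ⟨k, hk.symm⟩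

lemma key_sum (τ : ℂ) (hτ : 0 < τ.im) :
    (∑' n : ℕ, if Odd n then
      (∑ d ∈ n.divisors, ((d : ℂ) ^ 3)⁻¹) * Complex.exp (Complex.I * π * n * τ)
    else 0) = (Complex.I / 2) * ∑' d : ℕ, if Odd d then
      1 / ((d : ℂ) ^ 3 * Complex.sin (d * π * τ)) else 0 := by
  set q : ℂ := Complex.exp (Complex.I * π * τ) with hq
  have hqn : ‖q‖ < 1 := by
    rw [hq, Complex.norm_exp, Real.exp_lt_one_iff]
    have : (Complex.I * π * τ).re = -(π * τ.im) := by simp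
    rw [this]
    have := mul_pos Real.pi_pos hτ
    linarith
  have hexp : ∀ n : ℕ, Complex.exp (Complex.I * π * n * τ) = q ^ n := by
    intro n
    rw [hq, ← Complex.exp_nat_mul]; congr 1; ring
  let f : ℕ → ℕ → ℂ := fun a b => if Odd (a * b) then ((a : ℂ) ^ 3)⁻¹ * q ^ (a * b) else 0
  have hf : Summable (fun c : ℕ+ × ℕ+ => f c.1 c.2) := by
    have h0 := (summable_prod_mul_pow (𝕜 := ℂ) 0 hqn).norm
    refine Summable.of_norm_bounded h0 ?_
    rintro ⟨a, b⟩
    simp only [f, pow_zero, one_mul]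
    split_ifs
    · rw [norm_mul]
      refine mul_le_of_le_one_left (norm_nonneg _) ?_
      rw [norm_inv, norm_pow, Complex.norm_natCast]
      apply inv_le_one_of_one_le₀
      apply one_le_pow₀
      exact_mod_cast a.2
    · simp
  have h1 : (∑' c : ℕ+ × ℕ+, f c.1 c.2) = ∑' n : ℕ+, if Odd (n : ℕ) then
      (∑ d ∈ (n : ℕ).divisors, ((d : ℂ) ^ 3)⁻¹) * q ^ (n : ℕ) else 0 := by
    rw [← sigmaAntidiagonalEquivProd.tsum_eq]
    refine (Summable.tsum_sigma (sigmaAntidiagonalEquivProd.summable_iff.mpr hf)).trans ?_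
    refine tsum_congr fun n => ?_
    rw [tsum_fintype]
    have e1 : ∀ x : (n : ℕ).divisorsAntidiagonal,
        f (sigmaAntidiagonalEquivProd ⟨n, x⟩).1 (sigmaAntidiagonalEquivProd ⟨n, x⟩).2
          = f x.1.1 x.1.2 := fun x => rfl
    refine (Finset.sum_congr rfl fun x _ => e1 x).trans ?_
    rw [Finset.univ_eq_attach,
      (n : ℕ).divisorsAntidiagonal.sum_attach (fun x => f x.1 x.2)]
    have e2 : ∀ x ∈ (n : ℕ).divisorsAntidiagonal, f x.1 x.2 =
        if Odd (n : ℕ) then ((x.1 : ℂ) ^ 3)⁻¹ * q ^ (n : ℕ) else 0 := by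
      intro x hx
      simp only [f, (Nat.mem_divisorsAntidiagonal.mp hx).1]
    rw [Finset.sum_congr rfl e2]
    split_ifs
    · rw [Nat.sum_divisorsAntidiagonal (fun a _ => ((a : ℂ) ^ 3)⁻¹ * q ^ (n : ℕ)), Finset.sum_mul]
    · simp
  have h2 : (∑' c : ℕ+ × ℕ+, f c.1 c.2) = ∑' d : ℕ+, (Complex.I / 2) * if Odd (d : ℕ) then
      1 / (((d : ℕ) : ℂ) ^ 3 * Complex.sin ((d : ℕ) * π * τ)) else 0 := by
    rw [hf.tsum_prod]
    refine tsum_congr fun d => ?_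
    have hq0 : q ≠ 0 := Complex.exp_ne_zero _
    have hxn : ‖q ^ (d : ℕ)‖ < 1 := by
      rw [norm_pow]; exact pow_lt_one₀ (norm_nonneg _) hqn d.2.ne'
    by_cases hd : Odd (d : ℕ)
    · have hs := hasSum_odd_geom (q ^ (d : ℕ)) hxn
      have hs' : (∑' m : ℕ+, f d m) =
          ((((d : ℕ) : ℂ)) ^ 3)⁻¹ * (q ^ (d : ℕ) * (1 - (q ^ (d : ℕ)) ^ 2)⁻¹) := by
        rw [← hs.tsum_eq, ← tsum_mul_left,
          ← tsum_pnat_eq_tsum_of_eq_zero (f := fun m : ℕ => ((((d : ℕ) : ℂ)) ^ 3)⁻¹ *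
            (if Odd m then (q ^ (d : ℕ)) ^ m else 0)) (by simp)]
        refine tsum_congr fun m => ?_
        simp only [f, Nat.odd_mul, hd, true_and, pow_mul]
        split_ifs <;> simp
      change (∑' m : ℕ+, f d m) = _
      rw [hs', if_pos hd]
      have hsin : Complex.sin ((d : ℕ) * π * τ) =
          ((q ^ (d : ℕ))⁻¹ - q ^ (d : ℕ)) * Complex.I / 2 := by
        rw [Complex.sin, ← hexp, ← Complex.exp_neg]
        congr 4 <;> ring_nf
      rw [hsin]
      set x := q ^ (d : ℕ)
      have hx0 : x ≠ 0 := pow_ne_zero _ hq0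
      have hx1 : 1 - x ^ 2 ≠ 0 := by
        intro h
        have : ‖x ^ 2‖ = 1 := by rw [← sub_eq_zero.mp h]; simp
        rw [norm_pow] at this
        have := pow_lt_one₀ (norm_nonneg x) hxn two_ne_zero
        linarith
      have hd0 : ((d : ℕ) : ℂ) ≠ 0 := by exact_mod_cast d.2.ne'
      have hxx : x⁻¹ - x = (1 - x ^ 2) / x := by field_simp
      rw [hxx]
      field_simp
    · rw [if_neg hd]
      simp [f, Nat.odd_mul, hd]
  simp only [hexp]
  rw [← tsum_pnat_eq_tsum_of_eq_zero (by simp), ← h1, h2, ← tsum_mul_left,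
    ← tsum_pnat_eq_tsum_of_eq_zero (by simp)]

/-- Proposition 6.5. For a diophantine irrational `θ`, the boundary
value of the Eichler integral `G` along the vertical line at `θ` is `-Λ(θ)/32`. -/
theorem stmt_18 (θ : ℝ) (hirr : Irrational θ) (hdio : Diophantine θ) :
    Tendsto (fun t : ℝ => G ((θ : ℂ) + t * Complex.I))
      (nhdsWithin 0 (Set.Ioi 0)) (nhds (-(1 / 32) * ((Lam θ : ℝ) : ℂ))) := by
  obtain ⟨C, hC, hb⟩ := hdio (1 / 2) (by norm_num)
  have hsl := sin_lower θ C _ hb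
  have hT : Tendsto (fun t : ℝ => ∑' d : ℕ, if Odd d then
      1 / ((d : ℂ) ^ 3 * Complex.sin (d * π * ((θ : ℂ) + t * Complex.I))) else 0)
      (nhdsWithin 0 (Set.Ioi 0))
      (nhds (∑' d : ℕ, if Odd d then 1 / ((d : ℂ) ^ 3 * Complex.sin (d * π * (θ : ℂ))) else 0)) := by
    refine tendsto_tsum_of_dominated_convergence
      (bound := fun d : ℕ => 1 / (2 * C) * (1 / (d : ℝ) ^ (3 / 2 : ℝ))) ?_ ?_ ?_
    · exact (Real.summable_one_div_nat_rpow.mpr (by norm_num)).mul_left _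
    · intro d
      by_cases hd : Odd d
      · simp only [if_pos hd]
        have hd1 : 1 ≤ d := hd.pos
        have hdR : (0 : ℝ) < d := by exact_mod_cast hd1
        have hpos : 0 < |Real.sin (d * π * θ)| := lt_of_lt_of_le (by positivity) (hsl d hd1)
        have hne : Complex.sin (d * π * (θ : ℂ)) ≠ 0 := by
          have : Complex.sin (d * π * (θ : ℂ)) = ((Real.sin (d * π * θ) : ℝ) : ℂ) := by push_cast; rfl
          rw [this]
          exact_mod_cast abs_pos.mp hpos
        have hd0 : (d : ℂ) ≠ 0 := by exact_mod_cast hdR.ne'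
        have hcont : ContinuousAt (fun t : ℝ =>
            1 / ((d : ℂ) ^ 3 * Complex.sin (d * π * ((θ : ℂ) + t * Complex.I)))) 0 := by
          refine ContinuousAt.div continuousAt_const (by fun_prop) ?_
          simpa using And.intro (Nat.pos_iff_ne_zero.mp hd1) hne
        have := hcont.tendsto.mono_left (nhdsWithin_le_nhds (s := Set.Ioi (0 : ℝ)))
        simpa using this
      · simp only [if_neg hd]
        exact tendsto_const_nhds
    · refine Eventually.of_forall fun t d => ?_
      by_cases hd : Odd d
      · rw [if_pos hd]
        have hd1 : 1 ≤ d := hd.pos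
        have hdR : (0 : ℝ) < d := by exact_mod_cast hd1
        have e : (d : ℂ) * π * ((θ : ℂ) + t * Complex.I) =
            ((d * π * θ : ℝ) : ℂ) + ((d * π * t : ℝ) : ℂ) * Complex.I := by push_cast; ring
        have h1 := (hsl d hd1).trans (norm_sin_ge (d * π * θ) (d * π * t))
        rw [← e] at h1
        rw [norm_div, norm_one, norm_mul, norm_pow, Complex.norm_natCast, one_div_mul_one_div]
        refine one_div_le_one_div_of_le (by positivity) ?_
        have h2 : (d : ℝ) ^ (3 / 2 : ℝ) = (d : ℝ) ^ 3 * (d : ℝ) ^ (-1 - 1 / 2 : ℝ) := by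
          rw [← Real.rpow_natCast, ← Real.rpow_add hdR]; norm_num
        rw [h2]
        calc 2 * C * ((d : ℝ) ^ 3 * (d : ℝ) ^ (-1 - 1 / 2 : ℝ))
            = (d : ℝ) ^ 3 * (2 * (C * (d : ℝ) ^ (-1 - 1 / 2 : ℝ))) := by ring
          _ ≤ _ := by gcongr
      · rw [if_neg hd, norm_zero]
        positivity
  have hlim : (1 / (Complex.I * (π : ℂ)) ^ 3) * ((Complex.I / 2) *
      (∑' d : ℕ, if Odd d then 1 / ((d : ℂ) ^ 3 * Complex.sin (d * π * (θ : ℂ))) else 0))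
      = -(1 / 32) * ((Lam θ : ℝ) : ℂ) := by
    have e : ((∑' n : ℕ, if Odd n then 1 / ((n : ℝ) ^ 3 * Real.sin (n * π * θ)) else 0 : ℝ) : ℂ)
        = ∑' d : ℕ, if Odd d then 1 / ((d : ℂ) ^ 3 * Complex.sin (d * π * (θ : ℂ))) else 0 := by
      rw [Complex.ofReal_tsum]
      refine tsum_congr fun d => ?_
      split_ifs <;> push_cast <;> rfl
    rw [Lam, Complex.ofReal_mul, e]
    generalize (∑' d : ℕ, if Odd d then 1 / ((d : ℂ) ^ 3 *
      Complex.sin (d * π * (θ : ℂ))) else 0) = S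
    push_cast
    have hpi : (π : ℂ) ≠ 0 := by exact_mod_cast Real.pi_ne_zero
    rw [mul_pow, Complex.I_pow_three]
    field_simp
    ring
  rw [← hlim]
  refine Tendsto.congr' ?_ ((hT.const_mul _).const_mul _)
  filter_upwards [self_mem_nhdsWithin] with t ht
  rw [G, key_sum _ (by simpa using ht)]
end

section
/- Let θ be a diophantine irrational real number with θ > 0. Then Λ(θ+1) = -Λ(θ) and Λ(θ/(2θ+1))·(2θ+1)² - Λ(θ) = 2θ² + 2θ + 1. -/
open Real

/-- Indicator of odd positive integers. -/
noncomputable def od (n : ℕ+) : ℝ := if Odd (n : ℕ) then 1 else 0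

/-- The sign `(-1)^n`. -/
noncomputable def sg (n : ℕ+) : ℝ := (-1) ^ (n : ℕ)

lemma hs_congr {ι : Type*} {f g : ι → ℝ} {a b : ℝ} (h : HasSum f a) (hf : ∀ n, g n = f n)
    (hab : b = a) : HasSum g b := by
  rw [hab, show g = f from funext hf]; exact h

lemma parity_sums (f : ℕ+ → ℝ) (a e : ℝ) (ha : HasSum f a)
    (he : HasSum (fun n : ℕ+ => f (2 * n)) e) :
    HasSum (fun n => od n * f n) (a - e) ∧ HasSum (fun n => sg n * f n) (2 * e - a) := by
  have hinj : Function.Injective (fun n : ℕ+ => 2 * n) := fun a b h => by simpa using h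
  have hE : HasSum (fun n : ℕ+ => (1 - od n) * f n) e := by
    rw [← hinj.hasSum_iff]
    · refine hs_congr he (fun n => ?_) rfl
      have : ¬ Odd ((2 * n : ℕ+) : ℕ) := by
        rw [Nat.not_odd_iff_even, PNat.mul_coe]; exact even_two_mul _
      simp [od, -PNat.mul_coe, this]
    · intro n hn
      have : Odd (n : ℕ) := by
        by_contra h
        rw [Nat.not_odd_iff_even] at h
        obtain ⟨k, hk⟩ := h
        have hk0 : 0 < k := by have := n.pos; omega
        refine hn ⟨Nat.toPNat k hk0, ?_⟩
        apply PNat.eq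
        change 2 * k = (n : ℕ)
        omega
      simp [od, this]
  constructor
  · refine hs_congr (ha.sub hE) (fun n => ?_) rfl
    ring
  · refine hs_congr ((hE.mul_left 2).sub ha) (fun n => ?_) rfl
    have : sg n = 2 * (1 - od n) - 1 := by
      unfold sg od
      split_ifs with h
      · rw [h.neg_one_pow]; norm_num
      · rw [Nat.not_odd_iff_even] at h
        rw [h.neg_one_pow]; norm_num
    rw [this]; ring

lemma irr_sub_ne {x : ℝ} (hx : Irrational x) (n : ℕ) : x ^ 2 - (n : ℝ) ^ 2 ≠ 0 := by
  intro h
  have : (x - n) * (x + n) = 0 := by linarith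
  rcases mul_eq_zero.mp this with h | h
  · exact (hx.sub_natCast n).ne_zero h
  · exact (hx.add_natCast n).ne_zero h

lemma irr_sub_ne1 {x : ℝ} (hx : Irrational x) (n : ℕ) : x - (n : ℝ) ≠ 0 :=
  (hx.sub_natCast n).ne_zero

lemma irr_sub_ne2 {x : ℝ} (hx : Irrational x) (n : ℕ) : x + (n : ℝ) ≠ 0 :=
  (hx.add_natCast n).ne_zero

lemma cot_sum {x : ℝ} (hx : Irrational x) :
    HasSum (fun n : ℕ+ => 1 / (x ^ 2 - (n : ℝ) ^ 2))
      ((π * Real.cot (π * x) - 1 / x) / (2 * x)) := by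
  have hz : (x : ℂ) ∈ Complex.integerComplement := by
    rintro ⟨n, hn⟩
    have : (n : ℝ) = x := by exact_mod_cast hn
    exact hx ⟨n, by simpa using this⟩
  have hs : Summable (fun n : ℕ => (1 / ((x : ℂ) - (n + 1)) + 1 / ((x : ℂ) + (n + 1)))) :=
    summable_cotTerm hz
  have h := hs.hasSum
  rw [← cot_series_rep' hz] at h
  have h2 : HasSum (fun n : ℕ => (1 / (x - (n + 1)) + 1 / (x + (n + 1))))
      (π * Real.cot (π * x) - 1 / x) := by
    rw [← Complex.hasSum_ofReal]
    simpa using h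
  have h3 : HasSum (fun n : ℕ+ => (1 / (x - (n : ℕ)) + 1 / (x + (n : ℕ))))
      (π * Real.cot (π * x) - 1 / x) := by
    rw [hasSum_pnat_iff_hasSum_succ (f := fun n : ℕ => (1 / (x - n) + 1 / (x + n)))]
    simpa using h2
  refine hs_congr (h3.div_const (2 * x)) (fun n => ?_) rfl
  have h1 := irr_sub_ne1 hx n
  have h2 := irr_sub_ne2 hx n
  have h3 := irr_sub_ne hx n
  have h0 := hx.ne_zero
  field_simp
  ring

lemma sin_ne_s19 {x : ℝ} (hx : Irrational x) : Real.sin (π * x) ≠ 0 := by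
  rw [Real.sin_ne_zero_iff]
  intro n hn
  have : (n : ℝ) = x := by
    have := Real.pi_ne_zero
    field_simp at hn
    linarith
  exact hx ⟨n, by simpa using this⟩

lemma cot_sum_even {x : ℝ} (hx : Irrational x) :
    HasSum (fun n : ℕ+ => 1 / (x ^ 2 - ((2 * n : ℕ+) : ℝ) ^ 2))
      ((π * Real.cot (π * (x / 2)) - 2 / x) / (4 * x)) := by
  have hx2 : Irrational (x / 2) := by simpa using hx.div_natCast (m := 2) (by norm_num)
  have h := (cot_sum hx2).div_const 4
  refine hs_congr h (fun n => ?_) ?_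
  · have h3 := irr_sub_ne hx2 n
    have h4 := irr_sub_ne hx (2 * n)
    rw [PNat.mul_coe]
    push_cast at h4 ⊢
    rw [div_div]
    congr 1
    ring
  · have h0 := hx.ne_zero
    field_simp

lemma cot_half {x : ℝ} (hx : Irrational x) :
    Real.cot (π * (x / 2)) - Real.cot (π * x) = 1 / Real.sin (π * x) ∧
    Real.cot (π * (x / 2)) - 2 * Real.cot (π * x) = Real.tan (π * (x / 2)) := by
  have hx2 : Irrational (x / 2) := by simpa using hx.div_natCast (m := 2) (by norm_num)
  have h1 := sin_ne_s19 hx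
  have h2 := sin_ne_s19 hx2
  have e : π * x = 2 * (π * (x / 2)) := by ring
  rw [e] at h1 ⊢
  set y := π * (x / 2)
  rw [Real.cot_eq_cos_div_sin, Real.cot_eq_cos_div_sin, Real.tan_eq_sin_div_cos]
  rw [Real.sin_two_mul] at *
  have h3 : Real.cos y ≠ 0 := by
    intro h; simp [h] at h1
  have := Real.sin_sq_add_cos_sq y
  rw [Real.cos_two_mul]
  constructor
  · field_simp
    ring
  · field_simp
    linear_combination -this

lemma csc_sum {x : ℝ} (hx : Irrational x) :
    HasSum (fun n : ℕ+ => sg n * (1 / (x ^ 2 - (n : ℝ) ^ 2)))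
      ((π / Real.sin (π * x) - 1 / x) / (2 * x)) := by
  have h := (parity_sums _ _ _ (cot_sum hx) (cot_sum_even hx)).2
  convert h using 1
  have := (cot_half hx).1
  have h0 := hx.ne_zero
  rw [div_eq_mul_one_div π, ← this]
  field_simp
  ring

lemma tan_sum {x : ℝ} (hx : Irrational x) :
    HasSum (fun n : ℕ+ => od n * (1 / (x ^ 2 - (n : ℝ) ^ 2)))
      (- (π * Real.tan (π * (x / 2))) / (4 * x)) := by
  have h := (parity_sums _ _ _ (cot_sum hx) (cot_sum_even hx)).1
  convert h using 1
  rw [← (cot_half hx).2]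
  have h0 := hx.ne_zero
  field_simp
  ring

lemma zeta_pnat2 : HasSum (fun n : ℕ+ => 1 / (n : ℝ) ^ 2) (π ^ 2 / 6) := by
  have := hasSum_zeta_two
  rw [← hasSum_nat_add_iff' 1] at this
  rw [hasSum_pnat_iff_hasSum_succ (f := fun n : ℕ => 1 / (n : ℝ) ^ 2)]
  simpa using this

lemma zeta_pnat4 : HasSum (fun n : ℕ+ => 1 / (n : ℝ) ^ 4) (π ^ 4 / 90) := by
  have := hasSum_zeta_four
  rw [← hasSum_nat_add_iff' 1] at this
  rw [hasSum_pnat_iff_hasSum_succ (f := fun n : ℕ => 1 / (n : ℝ) ^ 4)]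
  simpa using this

lemma sums2 : HasSum (fun n : ℕ+ => od n * (1 / (n : ℝ) ^ 2)) (π ^ 2 / 8) ∧
    HasSum (fun n : ℕ+ => sg n * (1 / (n : ℝ) ^ 2)) (-π ^ 2 / 12) := by
  have h2 : HasSum (fun n : ℕ+ => 1 / ((2 * n : ℕ+) : ℝ) ^ 2) (π ^ 2 / 24) := by
    refine hs_congr (zeta_pnat2.div_const 4) (fun n => ?_) ?_
    · rw [PNat.mul_coe]; push_cast; rw [div_div]; congr 1; ring
    · ring
  have h := parity_sums _ _ _ zeta_pnat2 h2
  constructor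
  · convert h.1 using 1; ring
  · convert h.2 using 1; ring

lemma sums4 : HasSum (fun n : ℕ+ => od n * (1 / (n : ℝ) ^ 4)) (π ^ 4 / 96) := by
  have h2 : HasSum (fun n : ℕ+ => 1 / ((2 * n : ℕ+) : ℝ) ^ 4) (π ^ 4 / 1440) := by
    refine hs_congr (zeta_pnat4.div_const 16) (fun n => ?_) ?_
    · rw [PNat.mul_coe]; push_cast; rw [div_div]; congr 1; ring
    · ring
  have h := parity_sums _ _ _ zeta_pnat4 h2
  convert h.1 using 1; ring

/-- The weak diophantine condition that is used. -/
def WD (θ : ℝ) : Prop :=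
  ∃ C : ℝ, 0 < C ∧ ∀ n : ℕ, 1 ≤ n → ∀ ℓ : ℤ, C ≤ |(n : ℝ) * θ - (ℓ : ℝ)| * (n : ℝ) ^ (3 / 2 : ℝ)

lemma WD_of_dio {θ : ℝ} (h : Diophantine θ) : WD θ := by
  obtain ⟨C, hC, hb⟩ := h (1 / 2) (by norm_num)
  refine ⟨C, hC, fun n hn ℓ => ?_⟩
  have hn0 : (0 : ℝ) < n := by exact_mod_cast hn
  have := hb n hn ℓ
  calc C = C * (n : ℝ) ^ (-1 - 1 / 2 : ℝ) * (n : ℝ) ^ (3 / 2 : ℝ) := by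
        rw [mul_assoc, ← Real.rpow_add hn0]; norm_num
    _ ≤ _ := by gcongr

lemma WD_int {θ : ℝ} {C : ℝ}
    (hC : ∀ n : ℕ, 1 ≤ n → ∀ ℓ : ℤ, C ≤ |(n : ℝ) * θ - (ℓ : ℝ)| * (n : ℝ) ^ (3 / 2 : ℝ))
    (N ℓ : ℤ) (hN : N ≠ 0) : C ≤ |(N : ℝ) * θ - ℓ| * |(N : ℝ)| ^ (3 / 2 : ℝ) := by
  have h1 : 1 ≤ N.natAbs := by omega
  have hc : ((N.natAbs : ℕ) : ℝ) = |(N : ℝ)| := by rw [Nat.cast_natAbs]; push_cast; rfl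
  rcases le_total 0 N with h | h
  · have := hC N.natAbs h1 ℓ
    rw [hc] at this
    rwa [abs_of_nonneg (by exact_mod_cast h : (0 : ℝ) ≤ N)] at this ⊢
  · have := hC N.natAbs h1 (-ℓ)
    rw [hc] at this
    have h0 : (N : ℝ) ≤ 0 := by exact_mod_cast h
    rw [abs_of_nonpos h0] at this ⊢
    rwa [show -(N : ℝ) * θ - ((-ℓ : ℤ) : ℝ) = -(N * θ - ℓ) by push_cast; ring, abs_neg] at this

lemma WD_trans {θ : ℝ} (hpos : 0 < θ) (h : WD θ) : WD (θ / (2 * θ + 1)) := by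
  obtain ⟨C, hC, hb⟩ := h
  have hq : 0 < 2 * θ + 1 := by positivity
  set K : ℝ := (4 : ℝ) ^ (3 / 2 : ℝ) with hK
  have hK0 : 0 < K := by positivity
  refine ⟨min (min 1 (1 / (2 * θ + 1))) (C / (K * (2 * θ + 1))), by positivity, fun n hn ℓ => ?_⟩
  have hn1 : (1 : ℝ) ≤ n := by exact_mod_cast hn
  have hp1 : 1 ≤ (n : ℝ) ^ (3 / 2 : ℝ) := Real.one_le_rpow hn1 (by norm_num)
  set N : ℤ := n - 2 * ℓ with hN
  have key : (n : ℝ) * (θ / (2 * θ + 1)) - ℓ = (N * θ - ℓ) / (2 * θ + 1) := by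
    rw [hN]; push_cast; field_simp; ring
  by_cases hbig : 1 ≤ |(n : ℝ) * (θ / (2 * θ + 1)) - ℓ|
  · refine (min_le_left _ _).trans ((min_le_left _ _).trans ?_)
    nlinarith
  push Not at hbig
  by_cases hN0 : N = 0
  · refine (min_le_left _ _).trans ((min_le_right _ _).trans ?_)
    rw [key, hN0, abs_div, abs_of_pos hq]
    have hl : (1 : ℝ) ≤ |((0 : ℤ) : ℝ) * θ - ℓ| := by
      have : ℓ ≠ 0 := by omega
      simp only [Int.cast_zero, zero_mul, zero_sub, abs_neg]
      exact_mod_cast Int.one_le_abs this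
    calc 1 / (2 * θ + 1) ≤ |((0 : ℤ) : ℝ) * θ - ℓ| / (2 * θ + 1) * 1 := by
          rw [mul_one]; gcongr
      _ ≤ _ := by gcongr
  · refine (min_le_right _ _).trans ?_
    have hN4 : |(N : ℝ)| ≤ 4 * n := by
      have ht : θ / (2 * θ + 1) ≤ 1 / 2 := by
        rw [div_le_div_iff₀ hq (by norm_num)]; linarith
      have ht0 : 0 ≤ θ / (2 * θ + 1) := by positivity
      rw [abs_lt] at hbig
      have e1 : (n : ℝ) * (θ / (2 * θ + 1)) ≤ n * (1 / 2) := by gcongr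
      have e2 : 0 ≤ (n : ℝ) * (θ / (2 * θ + 1)) := by positivity
      rw [abs_le, hN]; push_cast
      constructor <;> linarith
    have h1 := WD_int hb N ℓ hN0
    have h2 : |(N : ℝ)| ^ (3 / 2 : ℝ) ≤ K * (n : ℝ) ^ (3 / 2 : ℝ) := by
      rw [hK, ← Real.mul_rpow (by norm_num) (by positivity)]
      gcongr
    rw [key, abs_div, abs_of_pos hq, div_le_iff₀ (by positivity)]
    calc C ≤ _ := h1
      _ ≤ |(N : ℝ) * θ - ℓ| * (K * (n : ℝ) ^ (3 / 2 : ℝ)) := by gcongr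
      _ = _ := by field_simp

/-- Weight on the integers. -/
noncomputable def hw (k : ℤ) : ℝ := 1 / (k : ℝ) ^ 2 + if k = 0 then 1 else 0

lemma hw_summable : Summable hw := by
  unfold hw
  refine Summable.add ?_ ?_
  · exact Real.summable_one_div_int_pow.mpr (by norm_num)
  · exact summable_of_ne_finset_zero (s := {0}) (by intro b hb; simpa using hb)

lemma dbl_bound {θ : ℝ} (hpos : 0 < θ) (hirr : Irrational θ) (h : WD θ) :
    ∃ B : ℝ, 0 ≤ B ∧ ∀ n m : ℕ, 1 ≤ n → 1 ≤ m →
      1 / ((n : ℝ) ^ 2 * |((n : ℝ) * θ) ^ 2 - (m : ℝ) ^ 2|) ≤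
        B * (1 / (n : ℝ) ^ (3 / 2 : ℝ)) * hw ((m : ℤ) - ⌊(n : ℝ) * θ⌋) := by
  obtain ⟨C, hC, hb⟩ := h
  refine ⟨4 + 1 / (C * θ), by positivity, fun n m hn hm => ?_⟩
  have hn1 : (1 : ℝ) ≤ n := by exact_mod_cast hn
  have hm1 : (1 : ℝ) ≤ m := by exact_mod_cast hm
  have hn0 : (0 : ℝ) < n := by linarith
  set x := (n : ℝ) * θ with hx
  have hx0 : 0 < x := by positivity
  have hxi : Irrational x := by
    rw [hx]; exact hirr.natCast_mul (by omega)
  set k : ℤ := (m : ℤ) - ⌊x⌋ with hk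
  have hf0 := Int.floor_le x
  have hf1 := Int.lt_floor_add_one x
  have hxm : |x - m| ≠ 0 := abs_ne_zero.mpr (irr_sub_ne1 hxi m)
  have hxm0 : 0 < |x - m| := lt_of_le_of_ne (abs_nonneg _) (Ne.symm hxm)
  have hfac : |x ^ 2 - (m : ℝ) ^ 2| = |x - m| * (x + m) := by
    rw [sq_sub_sq, abs_mul, abs_of_pos (by positivity : 0 < x + m)]; ring
  rw [hfac]
  set P := (n : ℝ) ^ (3 / 2 : ℝ) with hP
  have hP0 : 0 < P := by positivity
  have hPn : P ≤ (n : ℝ) ^ 2 := by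
    rw [hP, ← Real.rpow_natCast]
    exact Real.rpow_le_rpow_of_exponent_le hn1 (by norm_num)
  have hPP : P * P = (n : ℝ) ^ 3 := by
    rw [hP, ← Real.rpow_add hn0, ← Real.rpow_natCast]; norm_num
  have hmk : (m : ℝ) = k + ⌊x⌋ := by rw [hk]; push_cast; ring
  have hw0 : 0 ≤ hw k := by unfold hw; positivity
  by_cases hk01 : k = 0 ∨ k = 1
  · have hwk : 1 ≤ hw k := by rcases hk01 with h | h <;> rw [h] <;> simp [hw]
    have hd : C ≤ |x - m| * P := by simpa using hb n hn m
    have e1 : 1 / ((n : ℝ) ^ 2 * (|x - m| * (x + m))) ≤ 1 / (C * θ) * (1 / P) := by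
      rw [div_mul_div_comm, one_mul]
      apply one_div_le_one_div_of_le (by positivity)
      have : C * θ * P ≤ |x - m| * P * θ * P := by gcongr
      refine this.trans ?_
      calc |x - m| * P * θ * P = |x - m| * θ * (P * P) := by ring
        _ = (n : ℝ) ^ 2 * (|x - m| * x) := by rw [hPP, hx]; ring
        _ ≤ _ := by gcongr; linarith
    calc _ ≤ _ := e1
      _ ≤ (4 + 1 / (C * θ)) * (1 / P) * 1 := by rw [mul_one]; gcongr; linarith
      _ ≤ _ := by gcongr
  · push Not at hk01
    have hkr : (k : ℝ) ≠ 0 := by exact_mod_cast hk01.1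
    have hwk : hw k = 1 / (k : ℝ) ^ 2 := by simp [hw, hk01.1]
    have hd : |(k : ℝ)| / 2 ≤ |x - m| := by
      rcases lt_or_ge k 0 with h | h
      · have h' : (k : ℝ) ≤ -1 := by exact_mod_cast (by omega : k ≤ -1)
        rw [abs_of_nonpos (by linarith)]
        refine le_trans ?_ (le_abs_self _)
        linarith
      · have h' : (2 : ℝ) ≤ k := by exact_mod_cast (by omega : 2 ≤ k)
        rw [abs_of_nonneg (by linarith)]
        refine le_trans ?_ (neg_le_abs _)
        linarith
    have hd2 : |x - m| ≤ x + m := by rw [abs_le]; constructor <;> linarith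
    have hsq : (k : ℝ) ^ 2 / 4 ≤ |x - m| * (x + m) := by
      calc (k : ℝ) ^ 2 / 4 = |(k : ℝ)| / 2 * (|(k : ℝ)| / 2) := by
            rw [← sq_abs]; ring
        _ ≤ _ := by gcongr; exact hd.trans hd2
    rw [hwk]
    have hk2 : 0 < (k : ℝ) ^ 2 := by positivity
    calc 1 / ((n : ℝ) ^ 2 * (|x - m| * (x + m))) ≤ 1 / (P * ((k : ℝ) ^ 2 / 4)) := by
          apply one_div_le_one_div_of_le (by positivity)
          gcongr
      _ = 4 * (1 / P) * (1 / (k : ℝ) ^ 2) := by field_simp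
      _ ≤ _ := by
        gcongr
        have : 0 < 1 / (C * θ) := by positivity
        linarith

lemma abs_od_le (n : ℕ+) : |od n| ≤ 1 := by unfold od; split_ifs <;> simp
lemma abs_sg (n : ℕ+) : |sg n| = 1 := by unfold sg; simp

lemma F_summable {θ : ℝ} (hpos : 0 < θ) (hirr : Irrational θ) (h : WD θ) :
    Summable (fun p : ℕ+ × ℕ+ =>
      od p.1 * sg p.2 / ((p.1 : ℝ) ^ 2 * (((p.1 : ℝ) * θ) ^ 2 - (p.2 : ℝ) ^ 2))) := by
  obtain ⟨B, hB, hb⟩ := dbl_bound hpos hirr h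
  have hs1 : Summable (fun n : ℕ+ => B * (1 / ((n : ℕ) : ℝ) ^ (3 / 2 : ℝ))) := by
    apply Summable.mul_left
    have := Real.summable_one_div_nat_rpow.mpr (by norm_num : (1 : ℝ) < 3 / 2)
    exact this.comp_injective PNat.coe_injective
  have hs := hs1.mul_of_nonneg hw_summable (fun n => by dsimp; positivity)
    (fun k => by unfold hw; dsimp; positivity)
  have hinj : Function.Injective
      (fun p : ℕ+ × ℕ+ => (p.1, ((p.2 : ℕ) : ℤ) - ⌊((p.1 : ℕ) : ℝ) * θ⌋)) := by
    rintro ⟨a, b⟩ ⟨c, d⟩ hh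
    simp only [Prod.mk.injEq] at hh
    obtain ⟨rfl, h2⟩ := hh
    simp only [Prod.mk.injEq, true_and]
    apply PNat.eq
    have : ((b : ℕ) : ℤ) = (d : ℕ) := by linarith
    exact_mod_cast this
  refine Summable.of_norm_bounded (hs.comp_injective hinj) ?_
  rintro ⟨n, m⟩
  refine le_trans ?_ (hb n m n.pos m.pos)
  simp only [Real.norm_eq_abs, abs_div, abs_mul, abs_sg, mul_one, abs_pow, Nat.abs_cast]
  gcongr
  exact abs_od_le n

/-- The auxiliary 2-periodic function. -/
noncomputable def GG (x : ℝ) : ℝ := ∑' m : ℕ+, sg m / (m : ℝ) ^ 3 * Real.tan (π * (m * x / 2))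

lemma GG_periodic (x : ℝ) : GG (x + 2) = GG x := by
  unfold GG
  congr 1
  ext m
  have : π * ((m : ℝ) * (x + 2) / 2) = π * (m * x / 2) + (m : ℕ) * π := by ring
  rw [this, Real.tan_add_nat_mul_pi]

lemma key {θ : ℝ} (hpos : 0 < θ) (hirr : Irrational θ) (h : WD θ) :
    Lam θ = 8 * θ ^ 2 / π ^ 3 * GG (1 / θ) + 1 / (6 * θ) + θ / 3 := by
  have hpi := Real.pi_ne_zero
  have hF := F_summable hpos hirr h
  have hprod : HasSum (fun p : ℕ+ × ℕ+ =>
      (od p.1 * (1 / (p.1 : ℝ) ^ 2)) * (sg p.2 * (1 / (p.2 : ℝ) ^ 2)))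
      (π ^ 2 / 8 * (-π ^ 2 / 12)) := by
    have hsm := summable_mul_of_summable_norm sums2.1.summable.norm sums2.2.summable.norm
    exact hs_congr (HasSum.mul sums2.1 sums2.2 hsm) (fun p => rfl) rfl
  set T := ∑' p : ℕ+ × ℕ+,
      od p.1 * sg p.2 / ((p.1 : ℝ) ^ 2 * (((p.1 : ℝ) * θ) ^ 2 - (p.2 : ℝ) ^ 2)) with hT
  have hFT := hF.hasSum
  rw [← hT] at hFT
  have hirn : ∀ n : ℕ+, Irrational ((n : ℝ) * θ) := fun n => hirr.natCast_mul n.ne_zero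
  have hirm : ∀ n : ℕ+, Irrational ((n : ℝ) * (1 / θ)) := fun n => by
    rw [one_div]; exact hirr.inv.natCast_mul n.ne_zero
  -- rows
  have hrow : HasSum (fun n : ℕ+ => od n * (1 / (n : ℝ) ^ 2) *
      ((π / Real.sin (π * (n * θ)) - 1 / (n * θ)) / (2 * (n * θ)))) T := by
    refine hFT.prod_fiberwise fun n => ?_
    refine hs_congr ((csc_sum (hirn n)).mul_left (od n * (1 / (n : ℝ) ^ 2))) (fun m => ?_) rfl
    dsimp only
    rw [div_mul_eq_div_div]
    ring
  -- columns
  have hcol : HasSum (fun m : ℕ+ => sg m / (m : ℝ) ^ 2 * (1 / θ ^ 2) *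
      (π * Real.tan (π * (m * (1 / θ) / 2)) / (4 * (m * (1 / θ)))))
      ((T + π ^ 2 / 8 * (-π ^ 2 / 12)) / θ ^ 2) := by
    have h1 := ((hFT.add hprod).div_const (θ ^ 2))
    have h2 := (Equiv.prodComm ℕ+ ℕ+).hasSum_iff.mpr h1
    refine h2.prod_fiberwise fun m => ?_
    refine hs_congr ((tan_sum (hirm m)).mul_left (-(sg m / (m : ℝ) ^ 2 * (1 / θ ^ 2))))
      (fun n => ?_) ?_
    · have e1 := irr_sub_ne (hirn n) m
      have e2 := irr_sub_ne (hirm m) n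
      have hn : (n : ℝ) ≠ 0 := by exact_mod_cast n.ne_zero
      have hm : (m : ℝ) ≠ 0 := by exact_mod_cast m.ne_zero
      have e3 : ((m : ℝ) * (1 / θ)) ^ 2 - (n : ℝ) ^ 2 =
          - (((n : ℝ) * θ) ^ 2 - (m : ℝ) ^ 2) / θ ^ 2 := by field_simp; ring
      simp only [Function.comp, Equiv.prodComm_apply, Prod.swap]
      rw [e3]
      generalize hD : ((n : ℝ) * θ) ^ 2 - (m : ℝ) ^ 2 = D at *
      field_simp
      rw [← hD]; ring
    · ring
  have hGG : GG (1 / θ) * (π / (4 * θ)) = (T + π ^ 2 / 8 * (-π ^ 2 / 12)) / θ ^ 2 := by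
    rw [← hcol.tsum_eq, GG, ← tsum_mul_right]
    congr 1
    ext m
    have hm : (m : ℝ) ≠ 0 := by exact_mod_cast m.ne_zero
    generalize Real.tan (π * (m * (1 / θ) / 2)) = t
    field_simp
  have hS : HasSum (fun n : ℕ+ => if Odd (n : ℕ) then
      1 / (((n : ℕ) : ℝ) ^ 3 * Real.sin ((n : ℕ) * π * θ)) else 0)
      (2 * θ / π * T + 1 / (π * θ) * (π ^ 4 / 96)) := by
    refine hs_congr ((hrow.mul_left (2 * θ / π)).add (sums4.mul_left (1 / (π * θ))))
      (fun n => ?_) rfl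
    have hn : (n : ℝ) ≠ 0 := by exact_mod_cast n.ne_zero
    unfold od
    split_ifs with ho
    · have hs := sin_ne_s19 (hirn n)
      rw [show ((n : ℕ) : ℝ) * π * θ = π * (n * θ) by ring]
      generalize Real.sin (π * (n * θ)) = s at *
      field_simp
      ring
    · simp
  have hS' : HasSum (fun n : ℕ => if Odd n then
      1 / ((n : ℝ) ^ 3 * Real.sin (n * π * θ)) else 0)
      (2 * θ / π * T + 1 / (π * θ) * (π ^ 4 / 96)) := by
    rw [hasSum_pnat_iff_hasSum_succ (f := fun n : ℕ => if Odd n then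
      1 / ((n : ℝ) ^ 3 * Real.sin (n * π * θ)) else 0)] at hS
    rw [← hasSum_nat_add_iff' 1]
    simpa using hS
  unfold Lam
  rw [hS'.tsum_eq]
  have hTe : T = GG (1 / θ) * (π / (4 * θ)) * θ ^ 2 - π ^ 2 / 8 * (-π ^ 2 / 12) := by
    rw [hGG]; field_simp; ring
  rw [hTe]
  field_simp
  ring

/-- Corollary 6.7. For a positive diophantine irrational `θ`,
`Λ(θ+1) = -Λ(θ)` and `Λ(θ/(2θ+1))(2θ+1)² - Λ(θ) = 2θ² + 2θ + 1`. -/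
theorem stmt_19 (θ : ℝ) (hirr : Irrational θ) (hdio : Diophantine θ) (hpos : 0 < θ) :
    Lam (θ + 1) = -Lam θ ∧
      Lam (θ / (2 * θ + 1)) * (2 * θ + 1) ^ 2 - Lam θ = 2 * θ ^ 2 + 2 * θ + 1 := by
  constructor
  · unfold Lam
    rw [← mul_neg, ← tsum_neg]
    congr 2
    ext n
    split_ifs with ho
    · rw [show (n : ℝ) * π * (θ + 1) = n * π * θ + n * π by ring, Real.sin_add_nat_mul_pi,
        ho.neg_one_pow]
      rw [neg_one_mul, mul_neg, div_neg]
    · simp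
  · have hq : 0 < 2 * θ + 1 := by positivity
    have hinv : 1 / (θ / (2 * θ + 1)) = 1 / θ + 2 := by field_simp; ring
    have hirr' : Irrational (θ / (2 * θ + 1)) := by
      have h1 : Irrational (1 / θ + 2) := by
        rw [one_div]; simpa using hirr.inv.add_natCast 2
      rw [← hinv, one_div] at h1
      simpa using h1.inv
    have hw := WD_of_dio hdio
    rw [key hpos hirr hw, key (by positivity) hirr' (WD_trans hpos hw), hinv, GG_periodic]
    generalize GG (1 / θ) = g
    have hpi := Real.pi_ne_zero
    field_simp
    ring
end
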